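/- Let L: ℝ^p → ℝ be convex and β-smooth with minimizer θ*. Consider the noisy gradient descent iteration θ_{t+1} = θ_t − η(∇L(θ_t) + ζ_t) with η = 1/β, where ζ_t are independent mean-zero random vectors with E‖ζ_t‖² ≤ V. Then for θ̄ = (1/T) Σ_{t=1}^T θ_t, E[L(θ̄)] − L(θ*) ≤ β‖θ₀ − θ*‖²/(2T) + V/(2β). -/

import Mathlib

open MeasureTheory

/-- Derivative of `L` along a line. -/
lemma ngd_line {E : Type*} [NormedAddCommGroup E] [InnerProductSpace ℝ E] [CompleteSpace E]
    (L : E → ℝ) (gradL : E → E) (hgrad : ∀ x, HasGradientAt L (gradL x) x) (x v : E) (s : ℝ) :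
    HasDerivAt (fun s : ℝ => L (x + s • v)) (inner ℝ (gradL (x + s • v)) v) s := by
  have h1 : HasDerivAt (fun s : ℝ => x + s • v) v s := by
    simpa using ((hasDerivAt_id s).smul_const v).const_add x
  have h2 := (hgrad (x + s • v)).hasFDerivAt.comp_hasDerivAt s h1
  simpa using! h2

lemma ngd_first_order {E : Type*} [NormedAddCommGroup E] [InnerProductSpace ℝ E] [CompleteSpace E]
    (L : E → ℝ) (gradL : E → E) (hgrad : ∀ x, HasGradientAt L (gradL x) x)
    (hconv : ConvexOn ℝ Set.univ L) (x z : E) :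
    L x + inner ℝ (gradL x) (z - x) ≤ L z := by
  have h := ngd_line L gradL hgrad x (z - x) 0
  have hc : ConvexOn ℝ Set.univ (fun s : ℝ => L (x + s • (z - x))) := by
    refine ⟨convex_univ, fun a _ b _ c d hc hd hcd => ?_⟩
    have := hconv.2 (Set.mem_univ (x + a • (z - x))) (Set.mem_univ (x + b • (z - x))) hc hd hcd
    have e : x + (c • a + d • b) • (z - x)
        = c • (x + a • (z - x)) + d • (x + b • (z - x)) := by
      have : x = (c + d) • x := by rw [hcd, one_smul]
      nth_rewrite 1 [this]
      simp only [smul_eq_mul]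
      module
    simp only [e]
    exact this
  have := hc.le_slope_of_hasDerivAt (Set.mem_univ _) (Set.mem_univ _) zero_lt_one h
  simp [slope_def_field] at this
  linarith

lemma ngd_upper {E : Type*} [NormedAddCommGroup E] [InnerProductSpace ℝ E] [CompleteSpace E]
    (L : E → ℝ) (gradL : E → E) (hgrad : ∀ x, HasGradientAt L (gradL x) x) (β : ℝ)
    (x v : E) (hx : ∀ y, ‖gradL y‖ ≤ β * ‖y - x‖) :
    L (x + v) ≤ L x + β / 2 * ‖v‖ ^ 2 := by
  have hd : ∀ s : ℝ, HasDerivAt (fun s : ℝ => L (x + s • v) - β / 2 * ‖v‖ ^ 2 * s ^ 2)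
      (inner ℝ (gradL (x + s • v)) v - β / 2 * ‖v‖ ^ 2 * (2 * s)) s := by
    intro s
    refine (ngd_line L gradL hgrad x v s).sub ?_
    simpa using (hasDerivAt_pow 2 s).const_mul (β / 2 * ‖v‖ ^ 2)
  have ha := antitoneOn_of_hasDerivWithinAt_nonpos (convex_Icc (0 : ℝ) 1)
    (fun s _ => (hd s).continuousAt.continuousWithinAt)
    (fun s _ => (hd s).hasDerivWithinAt) (by
      intro s hs
      rw [interior_Icc] at hs
      have h1 := real_inner_le_norm (gradL (x + s • v)) v
      have h2 := hx (x + s • v)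
      rw [add_sub_cancel_left, norm_smul, Real.norm_of_nonneg hs.1.le] at h2
      have h3 := mul_le_mul_of_nonneg_right h2 (norm_nonneg v)
      nlinarith)
  have := ha (Set.left_mem_Icc.2 zero_le_one) (Set.right_mem_Icc.2 zero_le_one) zero_le_one
  simp at this
  linarith

/-- Deterministic one-step inequality. -/
lemma ngd_det {E : Type*} [NormedAddCommGroup E] [InnerProductSpace ℝ E] [CompleteSpace E]
    (L : E → ℝ) (gradL : E → E) (hgrad : ∀ x, HasGradientAt L (gradL x) x) (β : ℝ) (hβ : 0 < β)
    (hconv : ConvexOn ℝ Set.univ L)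
    (xs : E) (hx : ∀ y, ‖gradL y‖ ≤ β * ‖y - xs‖) (x z : E) :
    L x - L xs ≤ β / 2 * (‖x - xs‖ ^ 2 - ‖x - β⁻¹ • (gradL x + z) - xs‖ ^ 2)
      - inner ℝ z (x - β⁻¹ • gradL x - xs) + ‖z‖ ^ 2 / (2 * β) := by
  have h1 := ngd_first_order L gradL hgrad hconv x (xs + β⁻¹ • gradL x)
  have h2 := ngd_upper L gradL hgrad β xs (β⁻¹ • gradL x) hx
  generalize gradL x = g at *
  obtain ⟨d, rfl⟩ : ∃ d, x = xs + d := ⟨x - xs, by abel⟩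
  have e1 : xs + β⁻¹ • g - (xs + d) = β⁻¹ • g - d := by abel
  have e2 : xs + d - β⁻¹ • (g + z) - xs = d - β⁻¹ • (g + z) := by abel
  have e3 : xs + d - β⁻¹ • g - xs = d - β⁻¹ • g := by abel
  rw [e1] at h1
  rw [e2, e3, add_sub_cancel_left]
  rw [norm_smul, mul_pow, Real.norm_of_nonneg (by positivity)] at h2
  rw [norm_sub_sq_real d, norm_smul, mul_pow, Real.norm_of_nonneg (by positivity),
    norm_add_sq_real]
  simp only [inner_sub_right, inner_smul_right, inner_add_right, real_inner_self_eq_norm_sq] at *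
  rw [real_inner_comm g d, real_inner_comm z d] 
  rw [real_inner_comm z g]
  have k := h1.trans h2
  generalize (inner ℝ g d : ℝ) = gd at *
  generalize (inner ℝ z d : ℝ) = zd at *
  generalize (inner ℝ z g : ℝ) = zg at *
  refine le_of_sub_nonneg ?_
  refine (sub_nonneg.2 k).trans_eq ?_
  field_simp
  ring

/-- Convergence of noisy gradient descent on a convex, β-smooth objective with
step size 1/β: with independent mean-zero noises of second moment at most `V`,
the average iterate `θ̄` satisfies
`E[L(θ̄)] − L(θ*) ≤ β‖θ₀ − θ*‖²/(2T) + V/(2β)`. -/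
theorem noisy_gd_convergence {p : ℕ} (β V : ℝ) (hβ : 0 < β) (hV : 0 ≤ V)
    (L : EuclideanSpace ℝ (Fin p) → ℝ)
    (gradL : EuclideanSpace ℝ (Fin p) → EuclideanSpace ℝ (Fin p))
    (hgrad : ∀ x, HasGradientAt L (gradL x) x)
    (hconv : ConvexOn ℝ Set.univ L)
    (hsmooth : ∀ x y, ‖gradL x - gradL y‖ ≤ β * ‖x - y‖)
    (θstar : EuclideanSpace ℝ (Fin p)) (hmin : ∀ x, L θstar ≤ L x)
    {Ω : Type*} [MeasurableSpace Ω] (μ : Measure Ω) [IsProbabilityMeasure μ]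
    (T : ℕ) (hT : 0 < T)
    (θ : ℕ → Ω → EuclideanSpace ℝ (Fin p))
    (ζ : ℕ → Ω → EuclideanSpace ℝ (Fin p))
    (η : ℝ) (hη : η = 1 / β)
    (θ₀ : EuclideanSpace ℝ (Fin p)) (hθ₀ : ∀ ω, θ 0 ω = θ₀)
    (hstep : ∀ t ω, θ (t + 1) ω = θ t ω - η • (gradL (θ t ω) + ζ t ω))
    (hindep : ∀ t, ProbabilityTheory.IndepFun (ζ t) (θ t) μ)
    (hζint : ∀ t, Integrable (ζ t) μ) (hζmean : ∀ t, ∫ ω, ζ t ω ∂μ = 0)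
    (hζsq : ∀ t, Integrable (fun ω => ‖ζ t ω‖ ^ 2) μ)
    (hζvar : ∀ t, ∫ ω, ‖ζ t ω‖ ^ 2 ∂μ ≤ V)
    (hLint : ∀ t, Integrable (fun ω => L (θ t ω)) μ)
    (hθsq : ∀ t, Integrable (fun ω => ‖θ t ω - θstar‖ ^ 2) μ)
    (θbar : Ω → EuclideanSpace ℝ (Fin p))
    (hθbar : ∀ ω, θbar ω = (T : ℝ)⁻¹ • ∑ t ∈ Finset.range T, θ (t + 1) ω)
    (hLbarint : Integrable (fun ω => L (θbar ω)) μ) :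
    (∫ ω, L (θbar ω) ∂μ) - L θstar ≤
      β * ‖θ₀ - θstar‖ ^ 2 / (2 * T) + V / (2 * β) := by
  have hβ0 : β ≠ 0 := hβ.ne'
  have hη' : η = β⁻¹ := by rw [hη, one_div]
  subst hη'
  have hg0 : gradL θstar = 0 := by
    have h1 := (hgrad θstar).hasFDerivAt
    have h2 : IsLocalMin L θstar := Filter.Eventually.of_forall hmin
    have h3 := h2.hasFDerivAt_eq_zero h1
    simpa using h3
  have hx : ∀ y, ‖gradL y‖ ≤ β * ‖y - θstar‖ := fun y => by
    simpa [hg0] using hsmooth y θstar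
  have hgc : Continuous gradL := by
    refine (LipschitzWith.of_dist_le_mul (K := ⟨β, hβ.le⟩) fun x y => ?_).continuous
    rw [dist_eq_norm, dist_eq_norm]; exact hsmooth x y
  have hθm : ∀ t, AEStronglyMeasurable (θ t) μ := by
    intro t
    induction t with
    | zero =>
      have : θ 0 = fun _ => θ₀ := funext hθ₀
      rw [this]; exact aestronglyMeasurable_const
    | succ t ih =>
      have : θ (t + 1) = fun ω => θ t ω - β⁻¹ • (gradL (θ t ω) + ζ t ω) := funext (hstep t)
      rw [this]
      have hz := (hζint t).1
      have hg := hgc.comp_aestronglyMeasurable ih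
      fun_prop
  have hdint : ∀ t, Integrable (fun ω => θ t ω - θstar) μ := fun t =>
    ((memLp_two_iff_integrable_sq_norm ((hθm t).sub aestronglyMeasurable_const)).2
      (hθsq t)).integrable (by norm_num)
  have hgint : ∀ t, Integrable (fun ω => gradL (θ t ω)) μ := fun t =>
    ((hdint t).norm.const_mul β).mono' (hgc.comp_aestronglyMeasurable (hθm t))
      (Filter.Eventually.of_forall fun ω => hx _)
  let Y : EuclideanSpace ℝ (Fin p) → EuclideanSpace ℝ (Fin p) :=
    fun x => x - β⁻¹ • gradL x - θstar
  have hYint : ∀ t, Integrable (Y ∘ θ t) μ := fun t => by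
    refine ((hdint t).sub ((hgint t).smul β⁻¹)).congr (Filter.Eventually.of_forall fun ω => ?_)
    simp only [Y, Function.comp, Pi.sub_apply, Pi.smul_apply]
    abel
  have hYm : Measurable Y :=
    (((continuous_id.sub (hgc.const_smul β⁻¹)).sub continuous_const)).measurable
  have hind : ∀ t, ProbabilityTheory.IndepFun (ζ t) (Y ∘ θ t) μ := fun t =>
    (hindep t).comp measurable_id hYm
  have hinint : ∀ t, Integrable (fun ω => inner ℝ (ζ t ω) (Y (θ t ω))) μ := fun t =>
    (hind t).integrable_bilin (hζint t) (hYint t) (innerSL ℝ)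
  have hin0 : ∀ t, ∫ ω, inner ℝ (ζ t ω) (Y (θ t ω)) ∂μ = 0 := fun t => by
    have := (hind t).integral_bilin (hζint t) (hYint t) (innerSL ℝ)
    rw [hζmean t] at this
    simpa using! this
  let D : ℕ → ℝ := fun t => ∫ ω, ‖θ t ω - θstar‖ ^ 2 ∂μ
  let R : ℕ → ℝ := fun t => ∫ ω, L (θ t ω) ∂μ - L θstar
  have hR : ∀ t, R t = ∫ ω, (L (θ t ω) - L θstar) ∂μ := fun t => by
    rw [integral_sub (hLint t) (integrable_const _)]; simp [R]
  have hone : ∀ t, R t ≤ β / 2 * (D t - D (t + 1)) + V / (2 * β) := by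
    intro t
    have i1 : Integrable (fun ω => β / 2 * (‖θ t ω - θstar‖ ^ 2 - ‖θ (t + 1) ω - θstar‖ ^ 2)) μ := ((hθsq t).sub (hθsq (t + 1))).const_mul (β / 2)
    have i2 : Integrable (fun ω => β / 2 * (‖θ t ω - θstar‖ ^ 2 - ‖θ (t + 1) ω - θstar‖ ^ 2)
        - inner ℝ (ζ t ω) (Y (θ t ω))) μ := i1.sub (hinint t)
    have i3 := i2.add ((hζsq t).div_const (2 * β))
    have h1 : R t ≤ ∫ ω, (β / 2 * (‖θ t ω - θstar‖ ^ 2 - ‖θ (t + 1) ω - θstar‖ ^ 2)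
        - inner ℝ (ζ t ω) (Y (θ t ω)) + ‖ζ t ω‖ ^ 2 / (2 * β)) ∂μ := by
      rw [hR]
      refine integral_mono ((hLint t).sub (integrable_const _)) i3 fun ω => ?_
      have := ngd_det L gradL hgrad β hβ hconv θstar hx (θ t ω) (ζ t ω)
      rw [← hstep t ω] at this
      exact this
    have h2 : ∫ ω, (β / 2 * (‖θ t ω - θstar‖ ^ 2 - ‖θ (t + 1) ω - θstar‖ ^ 2)
        - inner ℝ (ζ t ω) (Y (θ t ω)) + ‖ζ t ω‖ ^ 2 / (2 * β)) ∂μ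
        = β / 2 * (D t - D (t + 1)) - 0 + (∫ ω, ‖ζ t ω‖ ^ 2 ∂μ) / (2 * β) := by
      rw [integral_add i2 ((hζsq t).div_const (2 * β)), integral_sub i1 (hinint t), hin0,
        integral_const_mul, integral_sub (hθsq t) (hθsq (t + 1)), integral_div]
    have h3 : (∫ ω, ‖ζ t ω‖ ^ 2 ∂μ) / (2 * β) ≤ V / (2 * β) :=
      div_le_div_of_nonneg_right (hζvar t) (by positivity)
    linarith
  have hlast : ∀ t, R t ≤ β / 2 * D t := by
    intro t
    rw [hR, ← integral_const_mul]
    refine integral_mono ((hLint t).sub (integrable_const _)) ((hθsq t).const_mul _) fun ω => ?_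
    have := ngd_upper L gradL hgrad β θstar (θ t ω - θstar) hx
    rw [add_sub_cancel] at this
    simp only
    linarith
  have hR0 : 0 ≤ R 0 := by
    rw [hR]; exact integral_nonneg fun ω => sub_nonneg.2 (hmin _)
  have hD0 : D 0 = ‖θ₀ - θstar‖ ^ 2 := by simp [D, hθ₀]
  have htel : ∀ n, ∑ t ∈ Finset.range n, R t ≤ β / 2 * (D 0 - D n) + n * (V / (2 * β)) := by
    intro n
    induction n with
    | zero => simp
    | succ n ih =>
      rw [Finset.sum_range_succ]
      push_cast
      linarith [hone n]
  have hsum : ∑ t ∈ Finset.range T, R (t + 1) ≤ β / 2 * D 0 + T * (V / (2 * β)) := by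
    have h1 := Finset.sum_range_succ R T
    have h2 := Finset.sum_range_succ' R T
    linarith [htel T, hlast T]
  have hT' : (0 : ℝ) < T := by exact_mod_cast hT
  have hjen : ∀ ω, L (θbar ω) ≤ ∑ t ∈ Finset.range T, (T : ℝ)⁻¹ * L (θ (t + 1) ω) := by
    intro ω
    rw [hθbar, Finset.smul_sum]
    refine hconv.map_sum_le (fun _ _ => by positivity) ?_ (fun _ _ => Set.mem_univ _)
    simp [hT'.ne']
  have hfin : ∫ ω, L (θbar ω) ∂μ ≤ ∑ t ∈ Finset.range T, (T : ℝ)⁻¹ * (R (t + 1) + L θstar) := by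
    have i : ∀ t ∈ Finset.range T, Integrable (fun ω => (T : ℝ)⁻¹ * L (θ (t + 1) ω)) μ :=
      fun t _ => (hLint _).const_mul _
    refine (integral_mono hLbarint (integrable_finsetSum _ i) hjen).trans_eq ?_
    rw [integral_finsetSum _ i]
    refine Finset.sum_congr rfl fun t _ => ?_
    rw [integral_const_mul]
    simp [R]
  rw [← Finset.mul_sum, Finset.sum_add_distrib] at hfin
  simp only [Finset.sum_const, Finset.card_range, nsmul_eq_mul] at hfin
  rw [← hD0]
  have h5 : (T : ℝ)⁻¹ * (∑ t ∈ Finset.range T, R (t + 1) + T * L θstar)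
      ≤ (T : ℝ)⁻¹ * (β / 2 * D 0 + T * (V / (2 * β)) + T * L θstar) := by gcongr
  have h6 : (T : ℝ)⁻¹ * (β / 2 * D 0 + T * (V / (2 * β)) + T * L θstar)
      = β * D 0 / (2 * T) + V / (2 * β) + L θstar := by field_simp
  linarith
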